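/- arXiv:1212.1626 — 2 statements merged into one kernel-verified Lean document; each statement's English description precedes it below -/
import Mathlib

section
/- Let E be a finite-dimensional real normed vector space, V a linear subspace of E, and A : ℝ → (E →L[ℝ] E) a continuous family of continuous linear operators such that A(t)(V) ⊆ V for every t. If x : ℝ → E is differentiable with x'(t) = A(t)(x(t)) for all t and x(0) ∈ V, then x(t) ∈ V for all t. -/
/-- A forward solution of a linear ODE whose coefficients preserve a closed complemented subspace
stays in that subspace if it starts there. -/
theorem mem_of_hasDerivAt_of_nonneg
    {E : Type*} [NormedAddCommGroup E] [NormedSpace ℝ E]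
    {V : Submodule ℝ E} (hV : V.ClosedComplemented) {A : ℝ → (E →L[ℝ] E)} (hA : Continuous A)
    (hAV : ∀ t : ℝ, ∀ v ∈ V, A t v ∈ V)
    {x : ℝ → E} (hx : ∀ t : ℝ, HasDerivAt x (A t (x t)) t)
    (hx0 : x 0 ∈ V) {t : ℝ} (ht : 0 ≤ t) : x t ∈ V := by
  obtain ⟨p, hp⟩ := hV
  let P : E →L[ℝ] E := ContinuousLinearMap.id ℝ E - V.subtypeL.comp p
  have hP : ∀ y, P y = y - p y := fun y => rfl
  have hPV : ∀ v ∈ V, P v = 0 := fun v hv => by simp [hP, hp ⟨v, hv⟩]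
  have hPA : ∀ s y, P (A s y) = P (A s (P y)) := fun s y => by
    rw [hP y, map_sub, map_sub, hPV _ (hAV s _ (p y).2), sub_zero]
  have hPx : ∀ s, HasDerivAt (fun s => P (x s)) (P (A s (x s))) s :=
    fun s => P.hasFDerivAt.comp_hasDerivAt s (hx s)
  obtain ⟨C, hC⟩ := isCompact_Icc.exists_bound_of_continuousOn
    (s := Set.Icc 0 t) (f := fun s => P.comp (A s)) (by fun_prop)
  have hzero : P (x t) = 0 :=
    eq_zero_of_abs_deriv_le_mul_abs_self_of_eq_zero_right
      (fun s _ => (hPx s).continuousAt.continuousWithinAt)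
      (fun s _ => (hPx s).hasDerivWithinAt) (hPV _ hx0)
      (fun s hs => by
        rw [hPA]
        exact (P.comp (A s)).le_of_opNorm_le (hC s (Set.Ico_subset_Icc_self hs)) (P (x s)))
      t ⟨ht, le_rfl⟩
  rw [sub_eq_zero.mp ((hP (x t)).symm.trans hzero)]
  exact (p (x t)).2

/-- Linear ODE invariance: if a continuous family of operators `A t` preserves a
subspace `V`, then any solution of `x' = A t (x t)` starting in `V` stays in `V`. -/
theorem ode_subspace_invariance
    {E : Type*} [NormedAddCommGroup E] [NormedSpace ℝ E] [FiniteDimensional ℝ E]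
    (V : Submodule ℝ E) (A : ℝ → (E →L[ℝ] E)) (hA : Continuous A)
    (hAV : ∀ t : ℝ, ∀ v ∈ V, A t v ∈ V)
    (x : ℝ → E) (hx : ∀ t : ℝ, HasDerivAt x (A t (x t)) t)
    (hx0 : x 0 ∈ V) :
    ∀ t : ℝ, x t ∈ V := by
  have hV : V.ClosedComplemented := Submodule.ClosedComplemented.of_finiteDimensional V
  intro t
  rcases le_total 0 t with ht | ht
  · exact mem_of_hasDerivAt_of_nonneg hV hA hAV hx hx0 ht
  · have hy : ∀ s : ℝ, HasDerivAt (fun s => x (-s)) ((-A (-s)) (x (-s))) s := fun s => by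
      simpa [Function.comp_def] using (hx (-s)).scomp s (hasDerivAt_neg s)
    simpa using mem_of_hasDerivAt_of_nonneg hV (A := fun s => -A (-s)) (by fun_prop)
      (fun s v hv => V.neg_mem (hAV (-s) v hv)) hy (by simpa using hx0) (neg_nonneg.mpr ht)
end

section
/- Let E be a finite-dimensional real normed vector space, V a linear subspace of E, and A : ℝ → (E →L[ℝ] E) a continuous family of continuous linear operators such that A(s)(V) ⊆ V for every s. If τ : ℝ → (E →L[ℝ] E) is differentiable with τ'(s) = A(s) ∘ τ(s) for all s and τ(0) = id, then τ(s)(V) ⊆ V for all s. -/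
/-- A solution of `x' = A x` starting in a closed complemented subspace `V` preserved by each
`A s` stays in `V` at nonnegative times. -/
theorem Submodule.ClosedComplemented.mem_of_linear_ode_of_nonneg
    {E : Type*} [NormedAddCommGroup E] [NormedSpace ℝ E]
    {V : Submodule ℝ E} (hV : V.ClosedComplemented) {A : ℝ → (E →L[ℝ] E)} (hA : Continuous A)
    (hAV : ∀ s : ℝ, ∀ v ∈ V, A s v ∈ V) {x : ℝ → E}
    (hx : ∀ s : ℝ, HasDerivAt x (A s (x s)) s) (hx0 : x 0 ∈ V) {t : ℝ} (ht : 0 ≤ t) :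
    x t ∈ V := by
  obtain ⟨f, hf⟩ := hV
  let Q : E →L[ℝ] E := ContinuousLinearMap.id ℝ E - V.subtypeL.comp f
  have hQ : ∀ y, Q y = y - f y := fun y => rfl
  have hQV : ∀ y ∈ V, Q y = 0 := fun y hy => by
    rw [hQ, hf ⟨y, hy⟩, sub_self]
  have hQA : ∀ s y, Q (A s y) = Q (A s (Q y)) := fun s y => by
    rw [hQ y, map_sub, map_sub, hQV _ (hAV s _ (f y).2), sub_zero]
  obtain ⟨C, hC⟩ := (isCompact_Icc (a := (0 : ℝ)) (b := t)).exists_bound_of_continuousOn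
    hA.continuousOn
  have hderiv : ∀ s, HasDerivAt (fun s => Q (x s)) (Q (A s (x s))) s := fun s =>
    Q.hasFDerivAt.comp_hasDerivAt s (hx s)
  have hzero : Q (x t) = 0 :=
    eq_zero_of_abs_deriv_le_mul_abs_self_of_eq_zero_right (K := ‖Q‖ * C)
      (fun s _ => (hderiv s).continuousAt.continuousWithinAt)
      (fun s _ => (hderiv s).hasDerivWithinAt) (hQV _ hx0)
      (fun s hs => by
        rw [hQA, mul_assoc]
        exact Q.le_opNorm_of_le
          ((A s).le_of_opNorm_le (hC s (Set.Ico_subset_Icc_self hs)) _))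
      t (Set.right_mem_Icc.2 ht)
  rw [hQ, sub_eq_zero] at hzero
  exact hzero ▸ (f (x t)).2

/-- A solution of `x' = A x` starting in a closed complemented subspace `V` preserved by each
`A s` stays in `V` at all times. -/
theorem Submodule.ClosedComplemented.mem_of_linear_ode
    {E : Type*} [NormedAddCommGroup E] [NormedSpace ℝ E]
    {V : Submodule ℝ E} (hV : V.ClosedComplemented) {A : ℝ → (E →L[ℝ] E)} (hA : Continuous A)
    (hAV : ∀ s : ℝ, ∀ v ∈ V, A s v ∈ V) {x : ℝ → E}
    (hx : ∀ s : ℝ, HasDerivAt x (A s (x s)) s) (hx0 : x 0 ∈ V) (t : ℝ) :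
    x t ∈ V := by
  rcases le_total 0 t with ht | ht
  · exact hV.mem_of_linear_ode_of_nonneg hA hAV hx hx0 ht
  · have hrev : x (-(-t)) ∈ V :=
      hV.mem_of_linear_ode_of_nonneg (A := fun s => -A (-s)) (x := fun s => x (-s))
        (hA.comp continuous_neg).neg (fun s v hv => V.neg_mem (hAV _ v hv))
        (fun s => by simpa [Function.comp_def] using (hx (-s)).scomp s (hasDerivAt_neg s))
        (by simpa using hx0) (neg_nonneg.2 ht)
    rwa [neg_neg] at hrev

/-- If `τ' s = A s ∘ τ s`, `τ 0 = id`, and each `A s` preserves the subspace `V`,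
then each `τ s` preserves `V`. -/
theorem operator_ode_subspace_invariance
    {E : Type*} [NormedAddCommGroup E] [NormedSpace ℝ E] [FiniteDimensional ℝ E]
    (V : Submodule ℝ E) (A : ℝ → (E →L[ℝ] E)) (hA : Continuous A)
    (hAV : ∀ s : ℝ, ∀ v ∈ V, A s v ∈ V)
    (τ : ℝ → (E →L[ℝ] E))
    (hτ : ∀ s : ℝ, HasDerivAt τ ((A s).comp (τ s)) s)
    (hτ0 : τ 0 = ContinuousLinearMap.id ℝ E) :
    ∀ s : ℝ, ∀ v ∈ V, τ s v ∈ V := by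
  intro s v hv
  refine (Submodule.ClosedComplemented.of_finiteDimensional V).mem_of_linear_ode hA hAV
    (x := fun s => τ s v) (fun s => ?_) (by simpa [hτ0] using hv) s
  simpa using (hτ s).clm_apply (hasDerivAt_const s v)
end
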